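/- arXiv:1111.4379 — 4 statements merged into one kernel-verified Lean document; each statement's English description precedes it below -/
import Mathlib

section
/- (Proposition) Let J = Π_{n=1}^{N} Fin(d n) and let Ψ_0, Ψ'_0 : Fin r × J → ℂ be unit vectors, with reduced density matrices ρ = Tr_0(|Ψ_0⟩⟨Ψ_0|) and ρ' = Tr_0(|Ψ'_0⟩⟨Ψ'_0|). Then there exist local unitaries U^(1), …, U^(N) (with U^(n) a d(n)×d(n) unitary matrix) such that ρ' = (U^(1) ⊗ ⋯ ⊗ U^(N)) ρ (U^(1) ⊗ ⋯ ⊗ U^(N))† if and only if there exist an r×r unitary U^(0) and local unitaries U^(1), …, U^(N) such that Ψ'_0 = (U^(0) ⊗ U^(1) ⊗ ⋯ ⊗ U^(N)) Ψ_0. Here U^(1) ⊗ ⋯ ⊗ U^(N) denotes the Kronecker product acting on J, with entries Π_n U^(n)_{j_n k_n}. -/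
open Matrix

/-- Outer product |v⟩⟨v| of a vector. -/
noncomputable def outerProd {α : Type*} (v : α → ℂ) : Matrix α α ℂ :=
  fun x y => v x * (starRingEnd ℂ) (v y)

/-- Partial trace over the ancilla (the `Fin r` factor). -/
noncomputable def ptrace0 {r : ℕ} {J : Type*}
    (M : Matrix (Fin r × J) (Fin r × J) ℂ) : Matrix J J ℂ :=
  fun j j' => ∑ i : Fin r, M (i, j) (i, j')

/-- Kronecker product `U^(1) ⊗ ⋯ ⊗ U^(N)` of local matrices, acting on the
multi-index set `J = Π n, Fin (d n)`. -/
noncomputable def kron {N : ℕ} {d : Fin N → ℕ}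
    (U : ∀ n, Matrix (Fin (d n)) (Fin (d n)) ℂ) :
    Matrix (∀ n, Fin (d n)) (∀ n, Fin (d n)) ℂ :=
  fun j k => ∏ n, U n (j n) (k n)

/-- Two linear maps with the same pointwise norms differ by an isometry of the codomain. -/
theorem LinearMap.exists_linearIsometry_comp_eq {E V : Type*} [AddCommGroup E] [Module ℂ E]
    [NormedAddCommGroup V] [InnerProductSpace ℂ V] [FiniteDimensional ℂ V]
    (f g : E →ₗ[ℂ] V) (h : ∀ x, ‖f x‖ = ‖g x‖) :
    ∃ L : V →ₗᵢ[ℂ] V, ∀ x, L (f x) = g x := by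
  obtain ⟨s, hs⟩ := f.rangeRestrict.exists_rightInverse_of_surjective f.range_rangeRestrict
  have hfs : ∀ y : LinearMap.range f, f (s y) = y := fun y =>
    congrArg Subtype.val (LinearMap.congr_fun hs y)
  let L : LinearMap.range f →ₗᵢ[ℂ] V :=
    { toLinearMap := g ∘ₗ s
      norm_map' := fun y => by
        rw [LinearMap.comp_apply, ← h, hfs, Submodule.coe_norm] }
  refine ⟨L.extend, fun x => ?_⟩
  refine (L.extend_apply (f.rangeRestrict x)).trans ?_
  change g (s (f.rangeRestrict x)) = g x
  rw [← sub_eq_zero, ← map_sub, ← norm_eq_zero, ← h, map_sub, hfs, LinearMap.codRestrict_apply,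
    sub_self, norm_zero]

/-- Two matrices with the same Gram matrix differ by a unitary factor on the left. -/
theorem Matrix.exists_unitary_mul_eq_of_conjTranspose_mul_self_eq {m n : Type*}
    [Fintype m] [DecidableEq m] [Fintype n] [DecidableEq n] (C D : Matrix m n ℂ)
    (h : Cᴴ * C = Dᴴ * D) : ∃ V ∈ Matrix.unitaryGroup m ℂ, D = V * C := by
  have hsq : ∀ (M : Matrix m n ℂ) (x : EuclideanSpace ℂ n),
      ((‖Matrix.toEuclideanLin M x‖ ^ 2 : ℝ) : ℂ) = star x.ofLp ⬝ᵥ ((Mᴴ * M) *ᵥ x.ofLp) := by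
    intro M x
    have := inner_self_eq_norm_sq_to_K (𝕜 := ℂ) (Matrix.toEuclideanLin M x)
    push_cast
    rw [EuclideanSpace.inner_eq_star_dotProduct] at this
    refine this.symm.trans ?_
    rw [Matrix.ofLp_toLpLin, Matrix.toLin'_apply, ← Matrix.mulVec_mulVec,
      Matrix.dotProduct_mulVec, dotProduct_comm, Matrix.star_mulVec]
  obtain ⟨L, hL⟩ := LinearMap.exists_linearIsometry_comp_eq
    (Matrix.toEuclideanLin C) (Matrix.toEuclideanLin D) (fun x => by
      have := (hsq C x).trans ((congrArg _ (by rw [h])).trans (hsq D x).symm)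
      exact (sq_eq_sq₀ (norm_nonneg _) (norm_nonneg _)).1 (Complex.ofReal_injective this))
  let Φ := Matrix.toEuclideanCLM (n := m) (𝕜 := ℂ)
  have hV : Φ (Φ.symm L.toContinuousLinearMap) = L.toContinuousLinearMap := Φ.apply_symm_apply _
  refine ⟨Φ.symm L.toContinuousLinearMap, ?_, ?_⟩
  · rw [Matrix.mem_unitaryGroup_iff']
    apply EquivLike.injective Φ
    rw [map_mul, map_star, map_one, hV]
    exact (ContinuousLinearMap.norm_map_iff_adjoint_comp_self _).1 L.norm_map
  · refine Matrix.ext_of_mulVec_single fun j => ?_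
    have hj := hL (WithLp.toLp 2 (Pi.single j 1))
    rw [← L.coe_toContinuousLinearMap, ← hV] at hj
    have := congrArg WithLp.ofLp hj
    rw [Matrix.ofLp_toEuclideanCLM, Matrix.ofLp_toLpLin, Matrix.ofLp_toLpLin,
      Matrix.toLin'_apply, Matrix.toLin'_apply, Matrix.mulVec_mulVec] at this
    exact this.symm

/-- The reduced density matrix is `B * Bᴴ`, where `B` is the coefficient matrix of the vector. -/
theorem ptrace0_outerProd {r : ℕ} {J : Type*} (Ψ : Fin r × J → ℂ) :
    ptrace0 (outerProd Ψ) =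
      (Matrix.of fun j i => Ψ (i, j)) * (Matrix.of fun j i => Ψ (i, j))ᴴ := by
  ext j j'
  simp [ptrace0, outerProd, Matrix.mul_apply]

/-- A product operator `W ⊗ K` acts on coefficient matrices by `B ↦ K * B * Wᵀ`. -/
theorem forall_eq_sum_iff_of_eq_mul {m J : Type*} [Fintype m] [Fintype J]
    (W : Matrix m m ℂ) (K : Matrix J J ℂ) (Ψ Ψ' : m × J → ℂ) :
    (∀ i j, Ψ' (i, j) = ∑ i', ∑ j', W i i' * K j j' * Ψ (i', j')) ↔
      (Matrix.of fun j i => Ψ' (i, j)) = K * (Matrix.of fun j i => Ψ (i, j)) * Wᵀ := by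
  rw [← Matrix.ext_iff, forall_comm]
  refine forall₂_congr fun j i => ?_
  simp only [Matrix.mul_apply, Matrix.of_apply, Matrix.transpose_apply, Finset.sum_mul]
  refine Eq.congr_right (Finset.sum_congr rfl fun i' _ => Finset.sum_congr rfl fun j' _ => ?_)
  ring

/-- A mixed `N`-partite state `ρ'` is LU equivalent to `ρ` iff the purification
`Ψ'_0` is LU equivalent (with an extra unitary on the ancilla) to `Ψ_0`. -/
theorem mixed_LU_iff_purification_LU {r N : ℕ} {d : Fin N → ℕ}
    (Ψ0 Ψ0' : Fin r × (∀ n, Fin (d n)) → ℂ)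
    (hΨ0 : ∑ x, Ψ0 x * (starRingEnd ℂ) (Ψ0 x) = 1)
    (hΨ0' : ∑ x, Ψ0' x * (starRingEnd ℂ) (Ψ0' x) = 1)
    (ρ ρ' : Matrix (∀ n, Fin (d n)) (∀ n, Fin (d n)) ℂ)
    (hρ : ρ = ptrace0 (outerProd Ψ0))
    (hρ' : ρ' = ptrace0 (outerProd Ψ0')) :
    (∃ U : ∀ n, Matrix (Fin (d n)) (Fin (d n)) ℂ,
        (∀ n, U n ∈ Matrix.unitaryGroup (Fin (d n)) ℂ) ∧
        ρ' = kron U * ρ * (kron U)ᴴ) ↔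
    (∃ (U0 : Matrix (Fin r) (Fin r) ℂ) (U : ∀ n, Matrix (Fin (d n)) (Fin (d n)) ℂ),
        U0 ∈ Matrix.unitaryGroup (Fin r) ℂ ∧
        (∀ n, U n ∈ Matrix.unitaryGroup (Fin (d n)) ℂ) ∧
        ∀ i j, Ψ0' (i, j) =
          ∑ i' : Fin r, ∑ j' : ∀ n, Fin (d n), U0 i i' * kron U j j' * Ψ0 (i', j')) := by
  subst hρ hρ'
  simp only [ptrace0_outerProd, forall_eq_sum_iff_of_eq_mul]
  set B : Matrix (∀ n, Fin (d n)) (Fin r) ℂ := Matrix.of fun j i => Ψ0 (i, j)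
  set B' : Matrix (∀ n, Fin (d n)) (Fin r) ℂ := Matrix.of fun j i => Ψ0' (i, j)
  constructor
  · rintro ⟨U, hU, h⟩
    obtain ⟨V, hV, hVB⟩ := Matrix.exists_unitary_mul_eq_of_conjTranspose_mul_self_eq
      (kron U * B)ᴴ B'ᴴ (by
        simp only [Matrix.conjTranspose_conjTranspose, h, Matrix.conjTranspose_mul,
          Matrix.mul_assoc])
    refine ⟨Vᴴᵀ, U, Matrix.transpose_mem_unitaryGroup_iff.2 (Unitary.star_mem hV), hU, ?_⟩
    rw [Matrix.transpose_transpose, ← Matrix.conjTranspose_conjTranspose B', hVB,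
      Matrix.conjTranspose_mul, Matrix.conjTranspose_conjTranspose]
  · rintro ⟨W, U, hW, hU, h⟩
    refine ⟨U, hU, ?_⟩
    have hWW : Wᵀ * Wᵀᴴ = 1 :=
      Matrix.mem_unitaryGroup_iff.1 (Matrix.transpose_mem_unitaryGroup_iff.2 hW)
    rw [h, Matrix.conjTranspose_mul, Matrix.mul_assoc (kron U * B), ← Matrix.mul_assoc Wᵀ, hWW,
      Matrix.one_mul, Matrix.conjTranspose_mul]
    simp only [Matrix.mul_assoc]
end

section
/- (Existence of the HOSVD core tensor) For every tensor Ψ on local dimensions d(1),…,d(N) there exists a family of local unitaries U = (U^(1),…,U^(N)) such that Ω = U·Ψ is in HOSVD form: for every mode n, the mode-n Gram matrix G_n(Ω) is diagonal with real, nonnegative, non-increasing diagonal entries. -/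
open Matrix

/-- An `N`-partite tensor on local dimensions `d 1, …, d N`. -/
def Tensor {N : ℕ} (d : Fin N → ℕ) : Type := (∀ n, Fin (d n)) → ℂ

/-- Action of a family of local matrices on a tensor:
`(U·Ψ)(j) = Σ_k (Π_n U^(n)_{j_n k_n}) Ψ(k)`. -/
noncomputable def luAct {N : ℕ} {d : Fin N → ℕ}
    (U : ∀ n, Matrix (Fin (d n)) (Fin (d n)) ℂ) (Ψ : Tensor d) : Tensor d :=
  fun j => ∑ k : ∀ n, Fin (d n), (∏ n, U n (j n) (k n)) * Ψ k

/-- The mode-`n` Gram matrix of a tensor: its `(a,b)` entry is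
`Σ Ψ(j[n↦a])·conj(Ψ(j[n↦b]))`, summed over the indices in the other modes. -/
noncomputable def gram {N : ℕ} {d : Fin N → ℕ} (Ψ : Tensor d) (n : Fin N) :
    Matrix (Fin (d n)) (Fin (d n)) ℂ :=
  fun a b => ∑ j : ∀ m, Fin (d m),
    if j n = a then Ψ j * (starRingEnd ℂ) (Ψ (Function.update j n b)) else 0

/-- A tensor is in HOSVD (core) form if each mode-`n` Gram matrix is diagonal
with real, nonnegative, non-increasing diagonal entries. -/
def IsHOSVD {N : ℕ} {d : Fin N → ℕ} (Ω : Tensor d) : Prop :=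
  ∀ n : Fin N,
    (gram Ω n).IsDiag ∧
    (∀ a, (gram Ω n a a).im = 0 ∧ 0 ≤ (gram Ω n a a).re) ∧
    (∀ a b : Fin (d n), a ≤ b → (gram Ω n b b).re ≤ (gram Ω n a a).re)

/-- LU equivalence of tensors. -/
def LUEquiv {N : ℕ} {d : Fin N → ℕ} (Ψ Ψ' : Tensor d) : Prop :=
  ∃ U : ∀ n, Matrix (Fin (d n)) (Fin (d n)) ℂ,
    (∀ n, U n ∈ Matrix.unitaryGroup (Fin (d n)) ℂ) ∧ Ψ' = luAct U Ψ

open scoped ComplexConjugate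

/-- The sesquilinear expectation value of a product operator `⨂ m, K m` in the state `Ψ`. -/
noncomputable def productForm {N : ℕ} {d : Fin N → ℕ}
    (K : ∀ m, Matrix (Fin (d m)) (Fin (d m)) ℂ) (Ψ : Tensor d) : ℂ :=
  ∑ j : ∀ m, Fin (d m), ∑ j' : ∀ m, Fin (d m),
    (∏ m, K m (j m) (j' m)) * (Ψ j * conj (Ψ j'))

lemma prod_update_one_apply {N : ℕ} {d : Fin N → ℕ} (n : Fin N)
    (M : Matrix (Fin (d n)) (Fin (d n)) ℂ) (j j' : ∀ m, Fin (d m)) :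
    ∏ m, Function.update (fun m => (1 : Matrix (Fin (d m)) (Fin (d m)) ℂ)) n M m (j m) (j' m) =
      if Function.update j n (j' n) = j' then M (j n) (j' n) else 0 := by
  rw [← Finset.mul_prod_erase _ _ (Finset.mem_univ n), Function.update_self]
  split_ifs with h
  · rw [Finset.prod_eq_one, mul_one]
    intro m hm
    have hmn : m ≠ n := Finset.ne_of_mem_erase hm
    have : j m = j' m := by rw [← h, Function.update_of_ne hmn]
    rw [Function.update_of_ne hmn, this, one_apply_eq]
  · obtain ⟨m, hm⟩ := Function.ne_iff.mp h
    have hmn : m ≠ n := by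
      rintro rfl
      simp at hm
    rw [Function.update_of_ne hmn] at hm
    rw [Finset.prod_eq_zero (i := m) (by simp [hmn]), mul_zero]
    rw [Function.update_of_ne hmn, one_apply_ne hm]

lemma sum_ite_update_eq {N : ℕ} {d : Fin N → ℕ} (n : Fin N) (j : ∀ m, Fin (d m))
    (f : (∀ m, Fin (d m)) → ℂ) :
    ∑ j' : ∀ m, Fin (d m), (if Function.update j n (j' n) = j' then f j' else 0) =
      ∑ b, f (Function.update j n b) := by
  rw [← Finset.sum_filter]
  refine Finset.sum_bij' (fun j' _ => j' n) (fun b _ => Function.update j n b) ?_ ?_ ?_ ?_ ?_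
  · simp
  · simp
  · intro j' h
    exact (Finset.mem_filter.mp h).2
  · simp
  · intro j' h
    rw [(Finset.mem_filter.mp h).2]

/-- A product form acting on a single mode is the pairing with the Gram matrix of that mode. -/
lemma productForm_update_one {N : ℕ} {d : Fin N → ℕ} (n : Fin N)
    (M : Matrix (Fin (d n)) (Fin (d n)) ℂ) (Ψ : Tensor d) :
    productForm (Function.update (fun _ => 1) n M) Ψ = ∑ a, ∑ b, M a b * gram Ψ n a b := by
  have h1 : ∀ j : ∀ m, Fin (d m), ∑ j' : ∀ m, Fin (d m),
      (∏ m, Function.update (fun m => (1 : Matrix (Fin (d m)) (Fin (d m)) ℂ)) n M m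
        (j m) (j' m)) * (Ψ j * conj (Ψ j')) =
      ∑ b, M (j n) b * (Ψ j * conj (Ψ (Function.update j n b))) := by
    intro j
    have := sum_ite_update_eq n j (fun j' => M (j n) (j' n) * (Ψ j * conj (Ψ j')))
    simp only [Function.update_self] at this
    rw [← this]
    refine Finset.sum_congr rfl fun j' _ => ?_
    rw [prod_update_one_apply, ite_mul, zero_mul]
  simp only [productForm, h1, _root_.gram, Finset.mul_sum]
  rw [Finset.sum_comm]
  conv_rhs => rw [Finset.sum_comm]
  refine Finset.sum_congr rfl fun b _ => ?_
  rw [Finset.sum_comm]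
  refine Finset.sum_congr rfl fun j _ => ?_
  simp

lemma gram_eq_productForm {N : ℕ} {d : Fin N → ℕ} (Ψ : Tensor d) (n : Fin N)
    (a b : Fin (d n)) :
    gram Ψ n a b = productForm (Function.update (fun _ => 1) n (single a b 1)) Ψ := by
  rw [productForm_update_one]
  simp [single_apply, ite_and]

/-- Local matrices acting on the state conjugate the factors of a product form. -/
lemma productForm_luAct {N : ℕ} {d : Fin N → ℕ}
    (K U : ∀ m, Matrix (Fin (d m)) (Fin (d m)) ℂ) (Ψ : Tensor d) :
    productForm K (luAct U Ψ) =
      productForm (fun m => (U m)ᵀ * K m * (U m).map conj) Ψ := by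
  have expand : ∀ k k' : ∀ m, Fin (d m),
      ∏ m, ((U m)ᵀ * K m * (U m).map conj) (k m) (k' m) =
        ∑ j' : ∀ m, Fin (d m), ∑ j : ∀ m, Fin (d m),
          (∏ m, U m (j m) (k m)) * (∏ m, K m (j m) (j' m)) *
            ∏ m, conj (U m (j' m) (k' m)) := by
    intro k k'
    simp only [mul_apply, transpose_apply, map_apply, Finset.sum_mul]
    rw [Finset.prod_univ_sum, Fintype.piFinset_univ]
    refine Finset.sum_congr rfl fun j' _ => ?_
    rw [Finset.prod_univ_sum, Fintype.piFinset_univ]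
    simp only [Finset.prod_mul_distrib]
  simp only [productForm, expand, luAct, map_sum, map_mul, map_prod, Finset.mul_sum,
    Finset.sum_mul]
  simp only [← Fintype.sum_prod_type']
  let J := ∀ m, Fin (d m)
  let e : J × J × J × J ≃ J × J × J × J :=
    { toFun := fun x => (x.2.2.2, x.2.2.1, x.2.1, x.1)
      invFun := fun x => (x.2.2.2, x.2.2.1, x.2.1, x.1)
      left_inv := fun _ => rfl
      right_inv := fun _ => rfl }
  refine Fintype.sum_equiv e _ _ fun x => ?_
  simp only [e, Equiv.coe_fn_mk]
  ring

lemma transpose_mul_map_conj_of_mem_unitaryGroup {m : ℕ} {U : Matrix (Fin m) (Fin m) ℂ}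
    (hU : U ∈ unitaryGroup (Fin m) ℂ) : Uᵀ * U.map conj = 1 := by
  have h := congrArg transpose (mem_unitaryGroup_iff'.mp hU)
  rw [transpose_mul, transpose_one] at h
  exact h

/-- Under local unitaries each Gram matrix is conjugated by the unitary of its mode. -/
lemma gram_luAct {N : ℕ} {d : Fin N → ℕ} {U : ∀ m, Matrix (Fin (d m)) (Fin (d m)) ℂ}
    (hU : ∀ m, U m ∈ unitaryGroup (Fin (d m)) ℂ) (Ψ : Tensor d) (n : Fin N) :
    gram (luAct U Ψ) n = U n * gram Ψ n * (U n)ᴴ := by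
  ext a b
  have hK : (fun m => (U m)ᵀ * Function.update
        (fun m => (1 : Matrix (Fin (d m)) (Fin (d m)) ℂ)) n (single a b 1) m * (U m).map conj) =
      Function.update (fun _ => 1) n ((U n)ᵀ * single a b 1 * (U n).map conj) := by
    funext m
    rcases eq_or_ne m n with rfl | hmn
    · simp
    · simp [Function.update_of_ne hmn, transpose_mul_map_conj_of_mem_unitaryGroup (hU m)]
  have hM : ∀ c e, ((U n)ᵀ * single a b (1 : ℂ) * (U n).map conj : Matrix _ _ ℂ) c e = U n a c * conj (U n b e) := by
    intro c e
    simp [mul_apply, single_apply, ite_and]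
  rw [gram_eq_productForm, productForm_luAct, hK, productForm_update_one]
  simp only [hM, mul_apply, conjTranspose_apply, Finset.sum_mul]
  rw [Finset.sum_comm]
  refine Finset.sum_congr rfl fun e _ => Finset.sum_congr rfl fun c _ => ?_
  rw [starRingEnd_apply]
  ring

lemma gram_isHermitian {N : ℕ} {d : Fin N → ℕ} (Ψ : Tensor d) (n : Fin N) :
    (gram Ψ n).IsHermitian := by
  ext a b
  simp only [conjTranspose_apply, _root_.gram, ← Finset.sum_filter, star_sum]
  refine Finset.sum_bij' (fun j _ => Function.update j n a) (fun j _ => Function.update j n b)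
    ?_ ?_ ?_ ?_ ?_
  · simp
  · simp
  · intro j hj
    simp [← (Finset.mem_filter.mp hj).2]
  · intro j hj
    simp [← (Finset.mem_filter.mp hj).2]
  · intro j hj
    simp [← (Finset.mem_filter.mp hj).2, mul_comm]

lemma gram_apply_self {N : ℕ} {d : Fin N → ℕ} (Ψ : Tensor d) (n : Fin N) (a : Fin (d n)) :
    gram Ψ n a a =
      ((∑ j : ∀ m, Fin (d m), if j n = a then Complex.normSq (Ψ j) else 0 : ℝ) : ℂ) := by
  rw [_root_.gram, Complex.ofReal_sum]
  refine Finset.sum_congr rfl fun j _ => ?_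
  split_ifs with h
  · rw [← h, Function.update_eq_self, Complex.mul_conj]
  · simp

/-- A Hermitian matrix is unitarily diagonalizable with non-increasing diagonal. -/
lemma Matrix.IsHermitian.exists_unitary_conj_eq_diagonal_antitone {m : ℕ}
    {A : Matrix (Fin m) (Fin m) ℂ} (hA : A.IsHermitian) :
    ∃ U ∈ unitaryGroup (Fin m) ℂ, ∃ f : Fin m → ℝ, Antitone f ∧
      U * A * Uᴴ = diagonal fun i => (f i : ℂ) := by
  set σ : Equiv.Perm (Fin m) := Tuple.sort fun i => -hA.eigenvalues i
  set V : Matrix (Fin m) (Fin m) ℂ := ↑hA.eigenvectorUnitary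
  have hVV : Vᴴ * V = 1 := mem_unitaryGroup_iff'.mp hA.eigenvectorUnitary.2
  have hdiag : Vᴴ * A * V = diagonal fun i => (hA.eigenvalues i : ℂ) := by
    have h := hA.spectral_theorem
    rw [Unitary.conjStarAlgAut_apply] at h
    change A = V * _ * Vᴴ at h
    conv_lhs => rw [h]
    rw [← mul_assoc, ← mul_assoc, hVV, one_mul, mul_assoc, hVV, mul_one]
    rfl
  refine ⟨Vᴴ.submatrix σ id, ?_, fun i => hA.eigenvalues (σ i), ?_, ?_⟩
  · rw [mem_unitaryGroup_iff, star_eq_conjTranspose, conjTranspose_submatrix,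
      conjTranspose_conjTranspose, ← submatrix_mul _ _ _ _ _ Function.bijective_id, hVV,
      submatrix_one_equiv]
  · intro i j hij
    have := Tuple.monotone_sort (fun i => -hA.eigenvalues i) hij
    simpa using this
  · have h : Vᴴ.submatrix σ id * A = (Vᴴ * A).submatrix σ id := rfl
    rw [h, conjTranspose_submatrix, conjTranspose_conjTranspose,
      ← submatrix_mul _ _ _ _ _ Function.bijective_id, hdiag,
      submatrix_diagonal_equiv]
    rfl

/-- Existence of the HOSVD: every tensor can be brought to HOSVD core form by
a family of local unitaries. -/
theorem exists_HOSVD {N : ℕ} {d : Fin N → ℕ} (Ψ : Tensor d) :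
    ∃ U : ∀ n, Matrix (Fin (d n)) (Fin (d n)) ℂ,
      (∀ n, U n ∈ Matrix.unitaryGroup (Fin (d n)) ℂ) ∧ IsHOSVD (luAct U Ψ) := by
  choose U hU f hf hUf using
    fun n => (gram_isHermitian Ψ n).exists_unitary_conj_eq_diagonal_antitone
  refine ⟨U, hU, fun n => ⟨?_, fun a => ?_, fun a b hab => ?_⟩⟩
  · rw [gram_luAct hU, hUf]
    exact isDiag_diagonal _
  · rw [gram_apply_self]
    refine ⟨Complex.ofReal_im _, ?_⟩
    rw [Complex.ofReal_re]
    exact Finset.sum_nonneg fun j _ => by split_ifs <;> simp [Complex.normSq_nonneg]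
  · simpa [gram_luAct hU, hUf] using hf n hab
end

section
/- (Block symmetry of the HOSVD) Let Ω be a tensor in HOSVD form, let n be a mode, and let S^(n) be a d(n)×d(n) unitary matrix commuting with G_n(Ω) (equivalently, block diagonal conformally with the multiplicities of the distinct mode-n singular values). Then the tensor Ω' obtained by acting with S^(n) on mode n and the identity on all other modes is again in HOSVD form, and G_m(Ω') = G_m(Ω) for every mode m. -/
open Matrix

/-- Moving the `n`-th index from `a` to `c` identifies the two slices of the index set. -/
theorem sum_slice_update {N : ℕ} {d : Fin N → ℕ} (n : Fin N) (a c : Fin (d n))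
    (F : (∀ m, Fin (d m)) → ℂ) :
    (∑ j : ∀ m, Fin (d m), if j n = a then F (Function.update j n c) else 0) =
      ∑ j : ∀ m, Fin (d m), if j n = c then F j else 0 := by
  rw [← Finset.sum_filter, ← Finset.sum_filter]
  refine Finset.sum_bij' (fun j _ => Function.update j n c) (fun j _ => Function.update j n a)
    ?_ ?_ ?_ ?_ ?_
  · simp
  · simp
  · intro j hj
    obtain rfl : j n = a := by simpa using hj
    simp
  · intro j hj
    obtain rfl : j n = c := by simpa using hj
    simp
  · simp

/-- A family of local matrices that is trivial off mode `n` acts by contracting mode `n` only. -/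
theorem luAct_eq_sum_update {N : ℕ} {d : Fin N → ℕ} (Ψ : Tensor d) (n : Fin N)
    (U : ∀ m, Matrix (Fin (d m)) (Fin (d m)) ℂ) (hU : ∀ m, m ≠ n → U m = 1)
    (j : ∀ m, Fin (d m)) :
    luAct U Ψ j = ∑ a, U n (j n) a * Ψ (Function.update j n a) := by
  unfold luAct
  symm
  refine Finset.sum_of_injOn (fun a => Function.update j n a)
    (Function.update_injective j n).injOn (by simp) ?_ ?_
  · intro k _ hk
    obtain ⟨m, hm, hne⟩ : ∃ m, m ≠ n ∧ j m ≠ k m := by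
      by_contra! h
      refine hk ⟨k n, by simp, ?_⟩
      funext m
      rcases eq_or_ne m n with rfl | hm
      · simp
      · simp [hm, h m hm]
    rw [Finset.prod_eq_zero (Finset.mem_univ m), zero_mul]
    rw [hU m hm, Matrix.one_apply_ne hne]
  · intro a _
    congr 1
    rw [Finset.prod_eq_single n]
    · simp
    · intro m _ hm
      simp [hU m hm, hm]
    · simp

/-- Contraction of one mode with a unitary matrix preserves the inner product. -/
theorem sum_contract_mul_conj {N : ℕ} {d : Fin N → ℕ} (n : Fin N)
    (S : Matrix (Fin (d n)) (Fin (d n)) ℂ) (hS : S ∈ Matrix.unitaryGroup (Fin (d n)) ℂ)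
    (f g : (∀ m, Fin (d m)) → ℂ) :
    ∑ j : ∀ m, Fin (d m), (∑ c, S (j n) c * f (Function.update j n c)) *
        (starRingEnd ℂ) (∑ e, S (j n) e * g (Function.update j n e)) =
      ∑ j, f j * (starRingEnd ℂ) (g j) := by
  have hS' (c e : Fin (d n)) :
      ∑ x, S x c * (starRingEnd ℂ) (S x e) = if c = e then 1 else 0 := by
    have h := congrFun (congrFun (Matrix.mem_unitaryGroup_iff'.mp hS) e) c
    simp only [Matrix.mul_apply, Matrix.star_apply, Matrix.one_apply] at h
    simpa [mul_comm, eq_comm] using h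
  have hslice (F : (∀ m, Fin (d m)) → ℂ) :
      ∑ j, F j = ∑ x, ∑ j : ∀ m, Fin (d m), if j n = x then F j else 0 := by
    rw [Finset.sum_comm]
    simp
  have hmove (x c e : Fin (d n)) :
      (∑ j : ∀ m, Fin (d m), if j n = x then
        f (Function.update j n c) * (starRingEnd ℂ) (g (Function.update j n e)) else 0) =
      ∑ j : ∀ m, Fin (d m), if j n = c then
        f j * (starRingEnd ℂ) (g (Function.update j n e)) else 0 := by
    simpa using sum_slice_update n x c
      (fun j => f j * (starRingEnd ℂ) (g (Function.update j n e)))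
  calc
    _ = ∑ x, ∑ c, ∑ e, S x c * (starRingEnd ℂ) (S x e) *
          ∑ j : ∀ m, Fin (d m), if j n = x then
            f (Function.update j n c) * (starRingEnd ℂ) (g (Function.update j n e)) else 0 := by
      rw [hslice]
      refine Finset.sum_congr rfl fun x _ => ?_
      simp_rw [Finset.mul_sum]
      simp_rw [Finset.sum_comm (s := (Finset.univ : Finset (Fin (d n))))
        (t := (Finset.univ : Finset (∀ m, Fin (d m))))]
      refine Finset.sum_congr rfl fun j _ => ?_
      split_ifs with hj
      · subst hj
        rw [map_sum, Finset.sum_mul_sum]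
        simp only [map_mul, mul_mul_mul_comm]
      · simp
    _ = ∑ c, ∑ e, (∑ x, S x c * (starRingEnd ℂ) (S x e)) *
          ∑ j : ∀ m, Fin (d m), if j n = c then
            f j * (starRingEnd ℂ) (g (Function.update j n e)) else 0 := by
      simp_rw [hmove, Finset.sum_mul]
      rw [Finset.sum_comm]
      exact Finset.sum_congr rfl fun c _ => Finset.sum_comm
    _ = ∑ c, ∑ j : ∀ m, Fin (d m), if j n = c then
          f j * (starRingEnd ℂ) (g (Function.update j n c)) else 0 := by
      simp [hS']
    _ = ∑ j, f j * (starRingEnd ℂ) (g j) := by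
      rw [Finset.sum_comm]
      simp

/-- A unitary acting on mode `n` does not change the Gram matrices of the other modes. -/
theorem gram_luAct_of_ne {N : ℕ} {d : Fin N → ℕ} (Ψ : Tensor d) {n m : Fin N} (hmn : m ≠ n)
    (U : ∀ m, Matrix (Fin (d m)) (Fin (d m)) ℂ)
    (hUn : U n ∈ Matrix.unitaryGroup (Fin (d n)) ℂ) (hU : ∀ m, m ≠ n → U m = 1) :
    gram (luAct U Ψ) m = gram Ψ m := by
  ext a b
  have h := sum_contract_mul_conj n (U n) hUn (fun j => if j m = a then Ψ j else 0)
    (fun j => Ψ (Function.update j m b))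
  simp only [Function.update_of_ne hmn] at h
  unfold _root_.gram
  convert h using 2 with j _ j _
  · rw [luAct_eq_sum_update Ψ n U hU, luAct_eq_sum_update Ψ n U hU]
    simp only [Function.update_of_ne hmn.symm, Function.update_comm hmn]
    split_ifs <;> simp
  · split_ifs <;> simp

/-- A matrix acting on mode `n` alone acts on the mode-`n` Gram matrix by congruence. -/
theorem gram_luAct_self {N : ℕ} {d : Fin N → ℕ} (Ψ : Tensor d) (n : Fin N)
    (U : ∀ m, Matrix (Fin (d m)) (Fin (d m)) ℂ) (hU : ∀ m, m ≠ n → U m = 1) :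
    gram (luAct U Ψ) n = U n * gram Ψ n * star (U n) := by
  ext a b
  have hmove (c e : Fin (d n)) :
      gram Ψ n c e = ∑ j : ∀ m, Fin (d m), if j n = a then
        Ψ (Function.update j n c) * (starRingEnd ℂ) (Ψ (Function.update j n e)) else 0 := by
    simpa [_root_.gram] using (sum_slice_update n a c
      (fun j => Ψ j * (starRingEnd ℂ) (Ψ (Function.update j n e)))).symm
  simp only [Matrix.mul_apply, Matrix.star_apply, hmove]
  simp_rw [Finset.mul_sum, Finset.sum_mul, Finset.sum_comm (s := (Finset.univ : Finset (Fin (d n))))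
    (t := (Finset.univ : Finset (∀ m, Fin (d m))))]
  refine Finset.sum_congr rfl fun j _ => ?_
  split_ifs with hj
  · subst hj
    rw [luAct_eq_sum_update Ψ n U hU, luAct_eq_sum_update Ψ n U hU, map_sum, Finset.sum_mul_sum,
      Finset.sum_comm]
    refine Finset.sum_congr rfl fun e _ => Finset.sum_congr rfl fun c _ => ?_
    simp only [map_mul, Function.update_self, Function.update_idem, RCLike.star_def]
    ring
  · simp

/-- Block symmetry of the HOSVD: acting on mode `n` with a unitary commuting
with `G_n(Ω)` (identity on all other modes) preserves the HOSVD form and all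
the mode Gram matrices. -/
theorem hosvd_block_symmetry {N : ℕ} {d : Fin N → ℕ} (Ω : Tensor d)
    (hΩ : IsHOSVD Ω) (n : Fin N)
    (S : Matrix (Fin (d n)) (Fin (d n)) ℂ)
    (hS : S ∈ Matrix.unitaryGroup (Fin (d n)) ℂ)
    (hcomm : S * gram Ω n = gram Ω n * S)
    (U : ∀ m, Matrix (Fin (d m)) (Fin (d m)) ℂ)
    (hUn : U n = S) (hU : ∀ m, m ≠ n → U m = 1) :
    IsHOSVD (luAct U Ω) ∧ ∀ m, gram (luAct U Ω) m = gram Ω m := by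
  have hUS : U n ∈ Matrix.unitaryGroup (Fin (d n)) ℂ := hUn ▸ hS
  have hgram : ∀ m, gram (luAct U Ω) m = gram Ω m := by
    intro m
    rcases eq_or_ne m n with rfl | hmn
    · rw [gram_luAct_self Ω m U hU, hUn, hcomm, mul_assoc, Matrix.mem_unitaryGroup_iff.mp hS,
        mul_one]
    · exact gram_luAct_of_ne Ω hmn U hUS hU
  refine ⟨fun m => ?_, hgram⟩
  rw [hgram m]
  exact hΩ m
end

section
/- Consider the four-qubit pure states Ψ = (1/√10)(|0000⟩ + 2|0110⟩ + |1001⟩ + 2|1111⟩) and Ψ' = (1/√10)(|0000⟩ + 2|0110⟩ + |1001⟩ − 2|1111⟩), regarded as tensors on Fin 2 × Fin 2 × Fin 2 × Fin 2. Then (i) for every mode n ∈ {1,2,3,4}, the mode-n Gram matrices coincide, G_n(Ψ) = G_n(Ψ') (explicitly: G_1 = G_4 = diag(1/2, 1/2) and G_2 = G_3 = diag(1/5, 4/5)); but (ii) there exist no 2×2 unitary matrices U^(1), U^(2), U^(3), U^(4) with Ψ' = (U^(1) ⊗ U^(2) ⊗ U^(3) ⊗ U^(4))·Ψ, i.e.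 Ψ and Ψ' are LU inequivalent. -/
open Matrix

/-- Ψ = (1/√10)(|0000⟩ + 2|0110⟩ + |1001⟩ + 2|1111⟩) as a four-qubit tensor. -/
noncomputable def Ψex : Tensor (fun _ : Fin 4 => 2) :=
  fun j => (Real.sqrt 10 : ℂ)⁻¹ *
    (if j = ![0, 0, 0, 0] then 1
     else if j = ![0, 1, 1, 0] then 2
     else if j = ![1, 0, 0, 1] then 1
     else if j = ![1, 1, 1, 1] then 2
     else 0)

/-- Ψ' = (1/√10)(|0000⟩ + 2|0110⟩ + |1001⟩ − 2|1111⟩) as a four-qubit tensor. -/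
noncomputable def Ψex' : Tensor (fun _ : Fin 4 => 2) :=
  fun j => (Real.sqrt 10 : ℂ)⁻¹ *
    (if j = ![0, 0, 0, 0] then 1
     else if j = ![0, 1, 1, 0] then 2
     else if j = ![1, 0, 0, 1] then 1
     else if j = ![1, 1, 1, 1] then -2
     else 0)

theorem sum_fourqubit {M : Type*} [AddCommMonoid M] (f : (Fin 4 → Fin 2) → M) :
    ∑ k, f k = ∑ x : Fin 2 × Fin 2, ∑ y : Fin 2 × Fin 2, f ![x.1, y.1, y.2, x.2] := by
  rw [← Fintype.sum_prod_type']
  refine Fintype.sum_equiv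
    { toFun := fun k => ((k 0, k 3), (k 1, k 2))
      invFun := fun p => ![p.1.1, p.2.1, p.2.2, p.1.2]
      left_inv := fun k => by ext i; fin_cases i <;> rfl
      right_inv := fun _ => rfl } _ _ fun k => congrArg f ?_
  ext i; fin_cases i <;> rfl

/-- `Ψex` factors across the bipartition of the modes into the outer and the inner pair. -/
theorem Ψex_apply (a b c d : Fin 2) :
    Ψex ![a, b, c, d] =
      ((Real.sqrt 10 : ℂ)⁻¹ * if a = d then 1 else 0) *
        if b = c then (if b = 0 then 1 else 2) else 0 := by
  fin_cases a <;> fin_cases b <;> fin_cases c <;> fin_cases d <;> simp [Ψex]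

theorem Ψex'_apply (a b c d : Fin 2) :
    Ψex' ![a, b, c, d] = (Real.sqrt 10 : ℂ)⁻¹ *
      if a = d ∧ b = c then (if b = 0 then 1 else if a = 0 then 2 else -2) else 0 := by
  fin_cases a <;> fin_cases b <;> fin_cases c <;> fin_cases d <;> simp [Ψex']

theorem inv_sqrt_ten_mul_self : (Real.sqrt 10 : ℂ)⁻¹ * (Real.sqrt 10 : ℂ)⁻¹ = 1 / 10 := by
  rw [← mul_inv, ← Complex.ofReal_mul, Real.mul_self_sqrt (by norm_num)]
  norm_num

theorem update_fourqubit (a b c d e : Fin 2) :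
    Function.update ![a, b, c, d] 0 e = ![e, b, c, d] ∧
    Function.update ![a, b, c, d] 1 e = ![a, e, c, d] ∧
    Function.update ![a, b, c, d] 2 e = ![a, b, e, d] ∧
    Function.update ![a, b, c, d] 3 e = ![a, b, c, e] := by
  refine ⟨?_, ?_, ?_, ?_⟩ <;> ext i <;> fin_cases i <;> rfl

theorem gram_Ψex (n : Fin 4) :
    gram Ψex n = Matrix.diagonal
      (if n = 0 ∨ n = 3 then ![(1 : ℂ) / 2, 1 / 2] else ![(1 : ℂ) / 5, 4 / 5]) := by
  ext a b
  unfold _root_.gram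
  rw [sum_fourqubit]
  fin_cases n <;> fin_cases a <;> fin_cases b <;>
    simp [Fintype.sum_prod_type, update_fourqubit, Ψex_apply, Complex.conj_ofNat] <;>
    first
      | linear_combination 5 * inv_sqrt_ten_mul_self
      | linear_combination 2 * inv_sqrt_ten_mul_self
      | linear_combination 8 * inv_sqrt_ten_mul_self

theorem gram_Ψex' (n : Fin 4) :
    gram Ψex' n = Matrix.diagonal
      (if n = 0 ∨ n = 3 then ![(1 : ℂ) / 2, 1 / 2] else ![(1 : ℂ) / 5, 4 / 5]) := by
  ext a b
  unfold _root_.gram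
  rw [sum_fourqubit]
  fin_cases n <;> fin_cases a <;> fin_cases b <;>
    simp [Fintype.sum_prod_type, update_fourqubit, Ψex'_apply, Complex.conj_ofNat] <;>
    first
      | linear_combination 5 * inv_sqrt_ten_mul_self
      | linear_combination 2 * inv_sqrt_ten_mul_self
      | linear_combination 8 * inv_sqrt_ten_mul_self

theorem luAct_Ψex_factors (U : Fin 4 → Matrix (Fin 2) (Fin 2) ℂ) :
    ∃ F G : Fin 2 → Fin 2 → ℂ, ∀ a b c d,
      luAct (d := fun _ => 2) U Ψex ![a, b, c, d] = F a d * G b c := by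
  refine ⟨fun a d => ∑ x : Fin 2 × Fin 2, U 0 a x.1 * U 3 d x.2 *
      ((Real.sqrt 10 : ℂ)⁻¹ * if x.1 = x.2 then 1 else 0),
    fun b c => ∑ y : Fin 2 × Fin 2, U 1 b y.1 * U 2 c y.2 *
      if y.1 = y.2 then (if y.1 = 0 then 1 else 2) else 0, fun a b c d => ?_⟩
  unfold luAct
  rw [sum_fourqubit, Finset.sum_mul_sum]
  refine Finset.sum_congr rfl fun x _ => Finset.sum_congr rfl fun y _ => ?_
  rw [Ψex_apply, Fin.prod_univ_four]
  simp only [Matrix.cons_val]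
  ring

theorem not_LUEquiv_Ψex : ¬ LUEquiv Ψex Ψex' := by
  rintro ⟨U, -, hU⟩
  obtain ⟨F, G, h⟩ := luAct_Ψex_factors U
  rw [← hU] at h
  have minor : Ψex' ![0, 0, 0, 0] * Ψex' ![1, 1, 1, 1] =
      Ψex' ![0, 1, 1, 0] * Ψex' ![1, 0, 0, 1] := by
    simp only [h]; ring
  simp only [Ψex'_apply] at minor
  simp only [Fin.isValue, and_self, ↓reduceIte, one_ne_zero] at minor
  exact one_ne_zero (α := ℂ) (by
    linear_combination (-5 / 2) * minor - 10 * inv_sqrt_ten_mul_self)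

/-- The two four-qubit states have identical mode Gram matrices (with the
explicit values diag(1/2,1/2) for modes 1 and 4 and diag(1/5,4/5) for modes 2
and 3), yet they are not LU equivalent. -/
theorem fourqubit_same_singular_values_not_LUEquiv :
    ((∀ n : Fin 4, gram Ψex n = gram Ψex' n) ∧
      gram Ψex 0 = Matrix.diagonal ![(1 : ℂ)/2, 1/2] ∧
      gram Ψex 3 = Matrix.diagonal ![(1 : ℂ)/2, 1/2] ∧
      gram Ψex 1 = Matrix.diagonal ![(1 : ℂ)/5, 4/5] ∧
      gram Ψex 2 = Matrix.diagonal ![(1 : ℂ)/5, 4/5]) ∧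
    ¬ LUEquiv Ψex Ψex' := by
  refine ⟨⟨fun n => (gram_Ψex n).trans (gram_Ψex' n).symm, ?_, ?_, ?_, ?_⟩, not_LUEquiv_Ψex⟩ <;>
    simp [gram_Ψex]
end
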